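/- Let A₁,…,Aₙ be bounded linear operators on a Hilbert space H and m a positive integer. Then |Σₖ k·Aₖ − ((n+1)/2) Σₖ Aₖ|² ≤ [n²(n−1)(n+1)/12] · [(1/n) Σₖ |Aₖ|² − (1/n²)|Σₖ Aₖ|²] in the Loewner order, where |T|² := T*T. -/

import Mathlib

/-- The Cauchy-Schwarz inequality for a real-weighted sum in a star-ordered algebra. -/
lemma star_sum_smul_mul_self_le {R ι : Type*} [Ring R] [StarRing R] [PartialOrder R]
    [StarOrderedRing R] [Algebra ℝ R] [StarModule ℝ R] [PosSMulMono ℝ R]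
    (s : Finset ι) (c : ι → ℝ) (B : ι → R) :
    star (∑ k ∈ s, c k • B k) * (∑ k ∈ s, c k • B k) ≤
      (∑ k ∈ s, c k ^ 2) • ∑ k ∈ s, star (B k) * B k := by
  have h : 0 ≤ ∑ j ∈ s, ∑ k ∈ s, star (c k • B j - c j • B k) * (c k • B j - c j • B k) :=
    Finset.sum_nonneg fun j _ => Finset.sum_nonneg fun k _ => star_mul_self_nonneg _
  have e : ∑ j ∈ s, ∑ k ∈ s, star (c k • B j - c j • B k) * (c k • B j - c j • B k) =
      (2 : ℝ) • ((∑ k ∈ s, c k ^ 2) • ∑ k ∈ s, star (B k) * B k -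
        star (∑ k ∈ s, c k • B k) * (∑ k ∈ s, c k • B k)) := by
    have hexp : ∀ j k, star (c k • B j - c j • B k) * (c k • B j - c j • B k) =
        (c k ^ 2 • (star (B j) * B j) + c j ^ 2 • (star (B k) * B k)) -
          (star (c j • B j) * (c k • B k) + star (c k • B k) * (c j • B j)) := by
      intro j k
      simp only [star_sub, star_smul, star_trivial, sub_mul, mul_sub, smul_mul_assoc,
        mul_smul_comm, smul_smul]
      module
    have hsq : (∑ k ∈ s, c k ^ 2) • ∑ k ∈ s, star (B k) * B k =
        ∑ j ∈ s, ∑ k ∈ s, c j ^ 2 • (star (B k) * B k) := by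
      rw [Finset.sum_smul]
      simp only [Finset.smul_sum]
    have hprod : star (∑ k ∈ s, c k • B k) * (∑ k ∈ s, c k • B k) =
        ∑ j ∈ s, ∑ k ∈ s, star (c j • B j) * (c k • B k) := by
      rw [star_sum, Finset.sum_mul_sum]
    simp only [hexp, Finset.sum_sub_distrib, Finset.sum_add_distrib]
    rw [Finset.sum_comm (f := fun j k => c k ^ 2 • (star (B j) * B j)),
      Finset.sum_comm (f := fun j k => star (c k • B k) * (c j • B j)), ← hsq, ← hprod]
    module
  rw [e] at h
  have hhalf := smul_nonneg (by norm_num : (0 : ℝ) ≤ 1 / 2) h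
  rw [smul_smul, show (1 / 2 : ℝ) * 2 = 1 by norm_num, one_smul] at hhalf
  exact sub_nonneg.1 hhalf

/-- Expansion of the sum of squared deviations from the mean. -/
lemma sum_star_sub_mean_mul_self {R ι : Type*} [Ring R] [StarRing R] [Algebra ℝ R]
    [StarModule ℝ R] (s : Finset ι) (hs : s.Nonempty) (A : ι → R) :
    ∑ k ∈ s, star (A k - (1 / (s.card : ℝ)) • ∑ j ∈ s, A j) *
        (A k - (1 / (s.card : ℝ)) • ∑ j ∈ s, A j) =
      ∑ k ∈ s, star (A k) * A k -
        (1 / (s.card : ℝ)) • (star (∑ k ∈ s, A k) * ∑ k ∈ s, A k) := by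
  have hc : (s.card : ℝ) ≠ 0 := by exact_mod_cast hs.card_pos.ne'
  set S := ∑ j ∈ s, A j with hS
  simp only [star_sub, sub_mul, mul_sub, Finset.sum_sub_distrib]
  rw [← Finset.sum_mul, ← Finset.mul_sum, ← star_sum, ← hS, Finset.sum_const,
    ← Nat.cast_smul_eq_nsmul ℝ]
  simp only [star_smul, star_trivial, smul_mul_assoc, mul_smul_comm, smul_smul]
  match_scalars <;> field_simp
  ring

lemma sum_Icc_sub_midpoint (n : ℕ) :
    ∑ k ∈ Finset.Icc 1 n, ((k : ℝ) - ((n : ℝ) + 1) / 2) = 0 := by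
  have h : ∑ k ∈ Finset.Icc 1 n, (k : ℝ) = n * (n + 1) / 2 := by
    induction n with
    | zero => simp
    | succ n ih => rw [Finset.sum_Icc_succ_top (by omega), ih]; push_cast; ring
  rw [Finset.sum_sub_distrib, h]
  simp
  ring

lemma sum_Icc_sub_midpoint_sq (n : ℕ) :
    ∑ k ∈ Finset.Icc 1 n, ((k : ℝ) - ((n : ℝ) + 1) / 2) ^ 2 =
      n * ((n : ℝ) - 1) * (n + 1) / 12 := by
  have h : ∀ a : ℝ, ∑ k ∈ Finset.Icc 1 n, ((k : ℝ) - a) ^ 2 =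
      n * (n + 1) * (2 * n + 1) / 6 - a * n * (n + 1) + n * a ^ 2 := by
    intro a
    induction n with
    | zero => simp
    | succ n ih => rw [Finset.sum_Icc_succ_top (by omega), ih]; push_cast; ring
  rw [h]
  ring

/-- Mellin-transform application of the discrete Grüss inequality for operators:
`|Σₖ k·Aₖ − ((n+1)/2) Σₖ Aₖ|² ≤ [n²(n−1)(n+1)/12]·[(1/n) Σₖ |Aₖ|² − (1/n²)|Σₖ Aₖ|²]`
in the Loewner order, where `|T|² = T*T`. -/
theorem stmt18 {H : Type*} [NormedAddCommGroup H] [InnerProductSpace ℂ H]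
    [CompleteSpace H]
    (n : ℕ) (A : ℕ → H →L[ℂ] H) (m : ℕ) (hm : 0 < m) :
    star (∑ k ∈ Finset.Icc 1 n, (k : ℝ) • A k -
          (((n : ℝ) + 1) / 2) • ∑ k ∈ Finset.Icc 1 n, A k) *
        (∑ k ∈ Finset.Icc 1 n, (k : ℝ) • A k -
          (((n : ℝ) + 1) / 2) • ∑ k ∈ Finset.Icc 1 n, A k) ≤
      ((n : ℝ) ^ 2 * ((n : ℝ) - 1) * ((n : ℝ) + 1) / 12) •
        ((1 / (n : ℝ)) • ∑ k ∈ Finset.Icc 1 n, star (A k) * A k -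
          (1 / (n : ℝ) ^ 2) •
            (star (∑ k ∈ Finset.Icc 1 n, A k) * ∑ k ∈ Finset.Icc 1 n, A k)) := by
  rcases Nat.eq_zero_or_pos n with rfl | hn
  · simp
  have hn0 : (n : ℝ) ≠ 0 := by exact_mod_cast hn.ne'
  set M := (1 / (n : ℝ)) • ∑ k ∈ Finset.Icc 1 n, A k with hM
  have hX : ∑ k ∈ Finset.Icc 1 n, (k : ℝ) • A k -
      (((n : ℝ) + 1) / 2) • ∑ k ∈ Finset.Icc 1 n, A k =
      ∑ k ∈ Finset.Icc 1 n, ((k : ℝ) - ((n : ℝ) + 1) / 2) • (A k - M) := by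
    simp only [smul_sub, Finset.sum_sub_distrib]
    rw [← Finset.sum_smul, sum_Icc_sub_midpoint, zero_smul, sub_zero]
    simp only [sub_smul, Finset.sum_sub_distrib, ← Finset.smul_sum]
  have hV := sum_star_sub_mean_mul_self (Finset.Icc 1 n) (Finset.nonempty_Icc.2 hn) A
  rw [Nat.card_Icc, Nat.add_sub_cancel, ← hM] at hV
  rw [hX]
  refine (star_sum_smul_mul_self_le _ _ _).trans_eq ?_
  rw [sum_Icc_sub_midpoint_sq, hV]
  match_scalars <;> field_simp
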